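/- arXiv:1802.07776 — 5 statements merged into one kernel-verified Lean document; each statement's English description precedes it below -/
import Mathlib

section
/- Let R be a commutative ring, n a natural number, and a : Fin (n+1) → R. On M₂(R) let σ denote the standard involution σ(A) = adjugate A, i.e. σ[[p,q],[r,s]] = [[s,−q],[−r,p]]. Let e₁ = [[1,0],[0,0]] ∈ M₂(R), and for x, y : Fin (n+1) → M₂(R) define h(x,y) = ∑_i σ(x i) * (a i • y i). Then for all x and y the matrix h(x·e₁, y·e₁) (where x·e₁ means componentwise right multiplication by e₁) has all entries zero except possibly the (2,1)-entry; writing b_h(x,y) ∈ R for this (2,1)-entry, so that h(x·e₁, y·e₁) = b_h(x,y) • E₂₁ with E₂₁ = [[0,0],[1,0]], the map b_h is R-bilinear in x and y and is alternating: b_h(x,x) = 0 for all x. -/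
open Matrix

/-- The hermitian form `h(x,y) = ∑ i, σ (x i) * (a i • y i)` on `(M₂(R))^{n+1}`,
where `σ` is the standard involution (the adjugate) on `M₂(R)`. -/
def hermForm {R : Type*} [CommRing R] {n : ℕ} (a : Fin (n + 1) → R)
    (x y : Fin (n + 1) → Matrix (Fin 2) (Fin 2) R) : Matrix (Fin 2) (Fin 2) R :=
  ∑ i, (x i).adjugate * (a i • y i)

/-- The scalar form `b_h(x,y)`: the `(2,1)`-entry of `h (x·e₁, y·e₁)`. -/
def bForm {R : Type*} [CommRing R] {n : ℕ} (a : Fin (n + 1) → R)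
    (x y : Fin (n + 1) → Matrix (Fin 2) (Fin 2) R) : R :=
  hermForm a (fun i => x i * !![1, 0; 0, 0]) (fun i => y i * !![1, 0; 0, 0]) 1 0

theorem bForm_eq_sum {R : Type*} [CommRing R] {n : ℕ} (a : Fin (n + 1) → R)
    (x y : Fin (n + 1) → Matrix (Fin 2) (Fin 2) R) :
    bForm a x y = ∑ i, a i * (x i 0 0 * y i 1 0 - x i 1 0 * y i 0 0) := by
  simp only [bForm, hermForm, Matrix.sum_apply]
  refine Finset.sum_congr rfl fun i _ => ?_
  simp [Matrix.adjugate_fin_two, Matrix.mul_apply, Fin.sum_univ_two]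
  ring

/-- **Construction of the alternating form `b_h` from the hermitian form `h`**
(proof of Lemma 5.2 of the paper): on the submodule `(M₂(R))^{n+1}·e₁`, the
hermitian form `h` takes values in `R • E₂₁`, and the resulting scalar form
`b_h` is `R`-bilinear and alternating. -/
theorem hermForm_restrict_alternating
    (R : Type*) [CommRing R] (n : ℕ) (a : Fin (n + 1) → R) :
    (∀ x y : Fin (n + 1) → Matrix (Fin 2) (Fin 2) R,
      hermForm a (fun i => x i * !![1, 0; 0, 0]) (fun i => y i * !![1, 0; 0, 0])
        = bForm a x y • !![0, 0; 1, 0]) ∧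
    (∀ x x' y : Fin (n + 1) → Matrix (Fin 2) (Fin 2) R,
      bForm a (x + x') y = bForm a x y + bForm a x' y) ∧
    (∀ x y y' : Fin (n + 1) → Matrix (Fin 2) (Fin 2) R,
      bForm a x (y + y') = bForm a x y + bForm a x y') ∧
    (∀ (r : R) (x y : Fin (n + 1) → Matrix (Fin 2) (Fin 2) R),
      bForm a (r • x) y = r * bForm a x y) ∧
    (∀ (r : R) (x y : Fin (n + 1) → Matrix (Fin 2) (Fin 2) R),
      bForm a x (r • y) = r * bForm a x y) ∧
    (∀ x : Fin (n + 1) → Matrix (Fin 2) (Fin 2) R, bForm a x x = 0) := by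
  refine ⟨fun x y => ?_, fun x x' y => ?_, fun x y y' => ?_, fun r x y => ?_, fun r x y => ?_,
    fun x => ?_⟩
  · ext j k
    fin_cases j <;> fin_cases k <;>
      simp [bForm, hermForm, Matrix.sum_apply, Matrix.adjugate_fin_two, Matrix.mul_apply,
        Matrix.vecMul, dotProduct, Fin.sum_univ_two]
  · simp only [bForm_eq_sum, ← Finset.sum_add_distrib, Pi.add_apply, Matrix.add_apply]
    exact Finset.sum_congr rfl fun i _ => by ring
  · simp only [bForm_eq_sum, ← Finset.sum_add_distrib, Pi.add_apply, Matrix.add_apply]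
    exact Finset.sum_congr rfl fun i _ => by ring
  · simp only [bForm_eq_sum, Finset.mul_sum, Pi.smul_apply, Matrix.smul_apply, smul_eq_mul]
    exact Finset.sum_congr rfl fun i _ => by ring
  · simp only [bForm_eq_sum, Finset.mul_sum, Pi.smul_apply, Matrix.smul_apply, smul_eq_mul]
    exact Finset.sum_congr rfl fun i _ => by ring
  · rw [bForm_eq_sum]
    exact Finset.sum_eq_zero fun i _ => by ring
end

section
/- Let n ≥ 2 be a natural number and let ℍ denote the real quaternions (Quaternion ℝ). Let J be the (n+1)×(n+1) diagonal matrix over ℍ whose (0,0) entry is −1 and whose other diagonal entries are 1 (the Gram matrix of the hermitian form of signature (n,1)). Suppose α is a nonzero real number and g is an (n+1)×(n+1) matrix over ℍ such that gᴴ * J * g = α • J, where gᴴ is the conjugate transpose of g with respect to quaternionic conjugation. Then α > 0. -/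
open Matrix Quaternion

/-- The `(a, b)` entry of `gᴴ * J * g` for `J = diag(-1, 1, …, 1)`. -/
lemma conjTranspose_mul_diagonal_mul_apply (n : ℕ)
    (g : Matrix (Fin (n + 1)) (Fin (n + 1)) (Quaternion ℝ)) (a b : Fin (n + 1)) :
    (gᴴ * Matrix.diagonal (fun i => if i = 0 then (-1 : Quaternion ℝ) else 1) * g :
        Matrix (Fin (n + 1)) (Fin (n + 1)) (Quaternion ℝ)) a b
      = -(star (g 0 a) * g 0 b) + ∑ k : Fin n, star (g k.succ a) * g k.succ b := by
  rw [Matrix.mul_apply, Fin.sum_univ_succ]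
  simp [Matrix.mul_diagonal, Fin.succ_ne_zero]

/-- Cauchy–Schwarz for the standard quaternionic hermitian form. -/
lemma norm_sum_star_mul_sq_le {ι : Type*} (s : Finset ι) (u v : ι → Quaternion ℝ) :
    ‖∑ k ∈ s, star (u k) * v k‖ ^ 2 ≤ (∑ k ∈ s, ‖u k‖ ^ 2) * ∑ k ∈ s, ‖v k‖ ^ 2 := by
  refine le_trans ?_ (Finset.sum_mul_sq_le_sq_mul_sq s (fun k => ‖u k‖) (fun k => ‖v k‖))
  gcongr
  refine (norm_sum_le _ _).trans_eq ?_
  simp [norm_mul]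

/-- **Lemma 7.1 of the paper** (concrete form): a quaternionic hermitian form
of signature `(n,1)` with `n > 1` cannot be isometric to a negative real
rescaling of itself.  If `gᴴ * J * g = α • J` for a nonzero real `α`, where
`J = diag(-1, 1, …, 1)` over the Hamilton quaternions, then `α > 0`. -/
theorem rescaling_positive (n : ℕ) (hn : 2 ≤ n) (α : ℝ) (hα : α ≠ 0)
    (g : Matrix (Fin (n + 1)) (Fin (n + 1)) (Quaternion ℝ))
    (h : gᴴ * Matrix.diagonal (fun i => if i = 0 then (-1 : Quaternion ℝ) else 1) * g
        = α • Matrix.diagonal (fun i => if i = 0 then (-1 : Quaternion ℝ) else 1)) :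
    0 < α := by
  by_contra hneg
  have hlt : α < 0 := lt_of_le_of_ne (not_lt.mp hneg) hα
  have entry (a b : Fin (n + 1)) := (conjTranspose_mul_diagonal_mul_apply n g a b).symm.trans
    (congrFun (congrFun h a) b)
  have hdiag (a : Fin (n + 1)) (ha : a ≠ 0) :
      ∑ k : Fin n, ‖g k.succ a‖ ^ 2 = ‖g 0 a‖ ^ 2 + α := by
    have key : -(star (g 0 a) * g 0 a) + ∑ k : Fin n, star (g k.succ a) * g k.succ a
        = ((α : ℝ) : Quaternion ℝ) := by
      rw [entry a a, Matrix.smul_apply, Matrix.diagonal_apply_eq, if_neg ha]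
      ext <;> simp
    simp only [Quaternion.star_mul_self, Quaternion.normSq_eq_norm_mul_self] at key
    simp only [← Quaternion.algebraMap_def, ← map_sum, ← map_neg, ← map_add] at key
    replace key := Quaternion.algebraMap_injective key
    simp only [sq]
    linarith
  obtain ⟨a, b, ha, hb, hab⟩ : ∃ a b : Fin (n + 1), a ≠ 0 ∧ b ≠ 0 ∧ a ≠ b :=
    ⟨⟨1, by omega⟩, ⟨2, by omega⟩, by simp [Fin.ext_iff], by simp [Fin.ext_iff],
      by simp [Fin.ext_iff]⟩
  have hoff : ∑ k : Fin n, star (g k.succ a) * g k.succ b = star (g 0 a) * g 0 b := by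
    have key := entry a b
    rw [Matrix.smul_apply, Matrix.diagonal_apply_ne _ hab, smul_zero] at key
    exact (neg_add_eq_zero.mp key).symm
  have hcs := norm_sum_star_mul_sq_le Finset.univ (fun k : Fin n => g k.succ a)
    (fun k => g k.succ b)
  rw [hoff, norm_mul, Quaternion.norm_star, mul_pow, hdiag a ha, hdiag b hb] at hcs
  have hpa : 0 ≤ ‖g 0 a‖ ^ 2 + α := hdiag a ha ▸ by positivity
  have hpb : 0 ≤ ‖g 0 b‖ ^ 2 + α := hdiag b hb ▸ by positivity
  nlinarith
end

section
/- Let p be a prime number. Suppose x is a positive rational number such that for every prime q ≠ p the p-adic valuation padicValRat q x is even. Then either x = y² for some rational y, or x = p·y² for some rational y; moreover p itself is not the square of a rational number. Consequently, the group of such x modulo squares of nonzero rationals has order exactly 2. -/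
theorem Nat.exists_eq_sq_of_even_padicValNat {n : ℕ} (hn : n ≠ 0)
    (h : ∀ q : ℕ, q.Prime → Even (padicValNat q n)) : ∃ m : ℕ, n = m ^ 2 := by
  obtain ⟨a, b, hab, ha⟩ := Nat.sq_mul_squarefree n
  have ha0 : a ≠ 0 := ha.ne_zero
  have hb0 : b ≠ 0 := by rintro rfl; simp at hab; exact hn hab.symm
  have ha1 : a = 1 := by
    by_contra hne
    obtain ⟨q, hq, hqa⟩ := Nat.exists_prime_and_dvd hne
    have : Fact q.Prime := ⟨hq⟩
    have hv : padicValNat q a = 1 := by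
      apply le_antisymm
      · rw [← Nat.factorization_def a hq]
        exact ha.natFactorization_le_one q
      · exact one_le_padicValNat_of_dvd ha0 hqa
    have he := h q hq
    rw [← hab, padicValNat.mul (pow_ne_zero 2 hb0) ha0, padicValNat.pow, hv] at he
    rw [Nat.even_iff] at he
    omega
  exact ⟨b, by rw [← hab, ha1, mul_one]⟩

theorem Rat.exists_eq_sq_of_even_padicValRat {x : ℚ} (hx : 0 < x)
    (h : ∀ q : ℕ, q.Prime → Even (padicValRat q x)) : ∃ y : ℚ, x = y ^ 2 := by
  have hnum : 0 < x.num := Rat.num_pos.mpr hx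
  have hnat : x.num.natAbs ≠ 0 := by omega
  obtain ⟨m, hm⟩ := Nat.exists_eq_sq_of_even_padicValNat (mul_ne_zero hnat x.den_ne_zero) (by
    intro q hq
    have : Fact q.Prime := ⟨hq⟩
    have he := h q hq
    rw [padicValRat_def, padicValInt] at he
    rw [padicValNat.mul hnat x.den_ne_zero]
    rw [Int.even_iff] at he
    rw [Nat.even_iff]
    omega)
  have hd : (x.den : ℚ) ≠ 0 := by exact_mod_cast x.den_ne_zero
  refine ⟨m / x.den, ?_⟩
  have hcast : (x.num : ℚ) = (x.num.natAbs : ℚ) := by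
    rw [Nat.cast_natAbs, abs_of_pos hnum]
  have hm' : (x.num : ℚ) * x.den = (m : ℚ) ^ 2 := by rw [hcast]; exact_mod_cast hm
  rw [div_pow, ← hm']
  nth_rewrite 1 [← Rat.num_div_den x]
  field_simp

theorem even_padicValRat_mul_sq_iff {p : ℕ} (hp : p.Prime) {x y : ℚ} (hx : x ≠ 0) (hy : y ≠ 0) :
    Even (padicValRat p (x * y ^ 2)) ↔ Even (padicValRat p x) := by
  have : Fact p.Prime := ⟨hp⟩
  rw [padicValRat.mul hx (pow_ne_zero 2 hy), padicValRat.pow]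
  simp [Int.even_add]

theorem Rat.eq_sq_or_eq_prime_mul_sq {p : ℕ} (hp : p.Prime) {x : ℚ} (hx : 0 < x)
    (h : ∀ q : ℕ, q.Prime → q ≠ p → Even (padicValRat q x)) :
    (∃ y : ℚ, x = y ^ 2) ∨ (∃ y : ℚ, x = (p : ℚ) * y ^ 2) := by
  have : Fact p.Prime := ⟨hp⟩
  have hp0 : (0 : ℚ) < p := by exact_mod_cast hp.pos
  by_cases he : Even (padicValRat p x)
  · left
    refine Rat.exists_eq_sq_of_even_padicValRat hx fun q hq => ?_
    by_cases hqp : q = p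
    · exact hqp ▸ he
    · exact h q hq hqp
  · right
    obtain ⟨y, hy⟩ := Rat.exists_eq_sq_of_even_padicValRat (div_pos hx hp0) (fun q hq => by
      have : Fact q.Prime := ⟨hq⟩
      rw [padicValRat.div hx.ne' hp0.ne']
      by_cases hqp : q = p
      · subst hqp
        rw [padicValRat.self hp.one_lt, Int.even_sub]
        simp [he]
      · rw [padicValRat.of_nat, padicValNat_primes hqp]
        simpa using h q hq hqp)
    exact ⟨y, by rw [← hy]; field_simp⟩

/-- **Corollary 6.4 of the paper** (concrete form, `k = ℚ`): if `x` is a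
positive rational whose `q`-adic valuation is even for every prime `q ≠ p`,
then `x` is a square or `p` times a square; `p` itself is not a rational
square; and consequently the group of such `x` modulo nonzero rational squares
has order exactly `2`. -/
theorem positive_rationals_even_valuation_mod_squares (p : ℕ) (hp : p.Prime) :
    (∀ x : ℚ, 0 < x → (∀ q : ℕ, q.Prime → q ≠ p → Even (padicValRat q x)) →
      (∃ y : ℚ, x = y ^ 2) ∨ (∃ y : ℚ, x = (p : ℚ) * y ^ 2)) ∧
    (¬ ∃ y : ℚ, (p : ℚ) = y ^ 2) ∧
    Nat.card (Quot (fun x x' :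
        {x : ℚ // 0 < x ∧ ∀ q : ℕ, q.Prime → q ≠ p → Even (padicValRat q x)} =>
      ∃ y : ℚ, y ≠ 0 ∧ (x : ℚ) = (x' : ℚ) * y ^ 2)) = 2 := by
  have : Fact p.Prime := ⟨hp⟩
  have hp0 : (0 : ℚ) < p := by exact_mod_cast hp.pos
  have hodd : ¬ Even (padicValRat p (p : ℚ)) := by
    rw [padicValRat.self hp.one_lt]; decide
  refine ⟨fun x hx h => Rat.eq_sq_or_eq_prime_mul_sq hp hx h, ?_, ?_⟩
  · rintro ⟨y, hy⟩
    have hy0 : y ≠ 0 := by rintro rfl; simp [hp.ne_zero] at hy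
    apply hodd
    rw [hy, ← one_mul (y ^ 2), even_padicValRat_mul_sq_iff hp one_ne_zero hy0]
    simp
  · rw [Nat.card_eq_two_iff]
    refine ⟨Quot.mk _ ⟨1, one_pos, fun q _ _ => by simp⟩,
      Quot.mk _ ⟨p, hp0, fun q hq hqp => ?_⟩, fun heq => ?_, ?_⟩
    · have : Fact q.Prime := ⟨hq⟩
      rw [padicValRat.of_nat, padicValNat_primes hqp]
      simp
    · have hlift := congrArg (Quot.lift (fun x => Even (padicValRat p x.1)) (by
        rintro ⟨a, ha⟩ ⟨b, hb⟩ ⟨y, hy0, hy⟩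
        simp only at hy
        simp only [hy, even_padicValRat_mul_sq_iff hp hb.1.ne' hy0])) heq
      apply hodd
      change Even (padicValRat p 1) = Even (padicValRat p (p : ℚ)) at hlift
      rw [← hlift]
      simp
    · refine Set.eq_univ_of_forall fun z => ?_
      induction z using Quot.ind with
      | mk x =>
        obtain ⟨x, hx, h⟩ := x
        rcases Rat.eq_sq_or_eq_prime_mul_sq hp hx h with ⟨y, hy⟩ | ⟨y, hy⟩
        · have hy0 : y ≠ 0 := by rintro rfl; simp [hy] at hx
          exact Or.inl (Quot.sound ⟨y, hy0, by simpa using hy⟩)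
        · have hy0 : y ≠ 0 := by rintro rfl; simp [hy] at hx
          exact Or.inr (Quot.sound ⟨y, hy0, hy⟩)
end

section
/- For n ≥ 2 define E₀(n) = ((n+1)/2)·∏_{j=1}^{n+1} ((2^j + (−1)^j)/(4j))·|B_{2j}|, and for n odd define E₁(n) = ((n+1)/2)·∏_{j=1}^{n+1} ((2^{2j} − 1)/(4j))·|B_{2j}| · ∏_{j=1}^{(n+1)/2} 1/(2^{4j} − 1), where B_m denotes the m-th Bernoulli number (Mathlib's bernoulli, cast to ℝ). Set E_s(n) = E₀(n) if n is even and E_s(n) = E₁(n) if n is odd. Then the sequence E_s grows super-exponentially: for every real c > 0, the sequence E_s(n)/cⁿ tends to +∞ as n → ∞. -/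
open Filter Finset

/-- `χ(Γ⁰ₙ)`, the minimal covolume of a nonuniform lattice in `Sp(n,1)` for
`n` even (equation (1.1) of the paper). -/
noncomputable def E0 (n : ℕ) : ℝ :=
  ((n : ℝ) + 1) / 2 *
    ∏ j ∈ Finset.Icc 1 (n + 1),
      ((2 : ℝ) ^ j + (-1 : ℝ) ^ j) / (4 * j) * |((bernoulli (2 * j) : ℚ) : ℝ)|

/-- `χ(Γ¹ₙ)`, the minimal covolume of a nonuniform lattice in `Sp(n,1)` for
`n` odd (equation (1.2) of the paper). -/
noncomputable def E1 (n : ℕ) : ℝ :=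
  ((n : ℝ) + 1) / 2 *
    (∏ j ∈ Finset.Icc 1 (n + 1),
      ((2 : ℝ) ^ (2 * j) - 1) / (4 * j) * |((bernoulli (2 * j) : ℚ) : ℝ)|) *
    ∏ j ∈ Finset.Icc 1 ((n + 1) / 2), 1 / ((2 : ℝ) ^ (4 * j) - 1)

/-- `χ(Γ^s_n)` with `s = n mod 2`: the minimal covolume of a nonuniform
lattice in `Sp(n,1)`. -/
noncomputable def Es (n : ℕ) : ℝ := if Even n then E0 n else E1 n

open Nat in
/-- The Bernoulli numbers of even index satisfy `|B₂ₖ| ≥ 2 (2k)! / (2π)²ᵏ`. -/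
lemma two_mul_factorial_div_le_abs_bernoulli {k : ℕ} (hk : k ≠ 0) :
    2 * ((2 * k)! : ℝ) / (2 * Real.pi) ^ (2 * k) ≤ |((bernoulli (2 * k) : ℚ) : ℝ)| := by
  have hs := hasSum_zeta_nat hk
  have h1 := le_hasSum hs 1 fun j _ => by positivity
  have h2 := le_abs_self ((-1 : ℝ) ^ (k + 1) * 2 ^ (2 * k - 1) * Real.pi ^ (2 * k) *
    (bernoulli (2 * k) : ℚ) / (2 * k)!)
  have hpow : (2 : ℝ) ^ (2 * k) = 2 * 2 ^ (2 * k - 1) := by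
    rw [← _root_.pow_succ', Nat.sub_add_cancel (by lia)]
  simp only [abs_div, abs_mul, abs_pow, abs_neg, abs_one, one_pow, one_mul, Nat.abs_cast,
    Nat.abs_ofNat, abs_of_pos Real.pi_pos] at h2
  have h3 := h1.trans h2
  rw [Nat.cast_one, one_pow, div_one, le_div_iff₀ (by positivity), one_mul] at h3
  rw [div_le_iff₀ (by positivity), mul_pow, hpow]
  linarith

open Nat in
lemma tendsto_factorial_two_mul_div_pow_atTop :
    Tendsto (fun j : ℕ => ((2 * j)! : ℝ) / (8 * (2 * Real.pi) ^ (2 * j))) atTop atTop := by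
  have h := (FloorSemiring.tendsto_pow_div_factorial_atTop (2 * Real.pi)).comp
    (tendsto_id.const_mul_atTop' (show 0 < 2 by norm_num))
  have h' : Tendsto (fun j : ℕ => (2 * Real.pi) ^ (2 * j) / ((2 * j)! : ℝ)) atTop
      (nhdsWithin 0 (Set.Ioi 0)) :=
    tendsto_nhdsWithin_iff.2 ⟨h, Eventually.of_forall fun j => Set.mem_Ioi.2 (by positivity)⟩
  refine (h'.inv_tendsto_nhdsGT_zero.const_mul_atTop (show (0 : ℝ) < 1 / 8 by norm_num)).congr
    fun j => ?_
  simp only [Pi.inv_apply, inv_div]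
  field_simp

/-- Partial products of a positive sequence tending to infinity grow super-exponentially. -/
lemma tendsto_prod_Icc_div_pow_atTop {g : ℕ → ℝ} (hpos : ∀ j, 0 < g j)
    (hg : Tendsto g atTop atTop) {c : ℝ} (hc : 0 < c) :
    Tendsto (fun n : ℕ => (∏ j ∈ Finset.Icc 1 (n + 1), g j) / c ^ n) atTop atTop := by
  obtain ⟨N, hN⟩ := eventually_atTop.1 (hg.eventually_ge_atTop (2 * c))
  rw [← tendsto_add_atTop_iff_nat N]
  have hP : ∀ n, 0 < ∏ j ∈ Finset.Icc 1 n, g j := fun n => Finset.prod_pos fun j _ => hpos j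
  refine tendsto_atTop_of_geom_le (c := 2) (div_pos (hP _) (by positivity)) one_lt_two
    fun n => ?_
  have e : n + 1 + N = n + N + 1 := by ring
  rw [e, Finset.prod_Icc_succ_top (b := n + N + 1) (by lia), pow_succ, mul_div_mul_comm, mul_comm]
  refine mul_le_mul_of_nonneg_left ?_ (div_pos (hP _) (by positivity)).le
  rw [le_div_iff₀ hc]
  exact hN _ (by lia)

open Nat in
lemma factorial_div_le_two_pow_div_mul_abs_bernoulli {j : ℕ} (hj : 1 ≤ j) :
    ((2 * j)! : ℝ) / (8 * (2 * Real.pi) ^ (2 * j)) ≤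
      2 ^ j / (16 * j) * |((bernoulli (2 * j) : ℚ) : ℝ)| := by
  have hj' : (0 : ℝ) < j := by exact_mod_cast hj
  have h2 : (j : ℝ) ≤ 2 ^ j := by exact_mod_cast j.lt_two_pow_self.le
  calc ((2 * j)! : ℝ) / (8 * (2 * Real.pi) ^ (2 * j))
      = 1 / 16 * (2 * ((2 * j)! : ℝ) / (2 * Real.pi) ^ (2 * j)) := by field_simp; norm_num
    _ ≤ 2 ^ j / (16 * j) * |((bernoulli (2 * j) : ℚ) : ℝ)| := by
      refine mul_le_mul ?_ (two_mul_factorial_div_le_abs_bernoulli (by lia)) (by positivity)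
        (by positivity)
      rw [div_le_div_iff₀ (by norm_num) (by positivity)]
      linarith

lemma prod_one_div_two_pow_succ_le (m : ℕ) :
    ∏ j ∈ Finset.Icc 1 (2 * m), 1 / (2 : ℝ) ^ (j + 1) ≤
      ∏ j ∈ Finset.Icc 1 m, 1 / ((2 : ℝ) ^ (4 * j) - 1) := by
  induction m with
  | zero => simp
  | succ m ih =>
    rw [show 2 * (m + 1) = 2 * m + 1 + 1 by ring, Finset.prod_Icc_succ_top (by lia),
      Finset.prod_Icc_succ_top (by lia), Finset.prod_Icc_succ_top (by lia), mul_assoc]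
    have h1 : (1 : ℝ) < 2 ^ (4 * (m + 1)) := one_lt_pow₀ one_lt_two (by lia)
    refine mul_le_mul ih ?_ (by positivity) (le_trans (by positivity) ih)
    rw [div_mul_div_comm, one_mul, ← pow_add]
    refine one_div_le_one_div_of_le (by linarith) ?_
    have h2 : (2 : ℝ) ^ (4 * (m + 1)) ≤ 2 ^ (2 * m + 1 + 1 + (2 * m + 1 + 1 + 1)) :=
      pow_le_pow_right₀ one_le_two (by lia)
    linarith

lemma half_prod_le_E0 (n : ℕ) :
    1 / 2 * ∏ j ∈ Finset.Icc 1 (n + 1), (2 : ℝ) ^ j / (16 * j) * |((bernoulli (2 * j) : ℚ) : ℝ)|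
      ≤ E0 n := by
  unfold E0
  refine mul_le_mul ?_ (Finset.prod_le_prod (fun j _ => by positivity) fun j hj => ?_)
    (Finset.prod_nonneg fun j _ => by positivity) (by positivity)
  · have : (0 : ℝ) ≤ n := n.cast_nonneg
    linarith
  · have hj1 : 1 ≤ j := (Finset.mem_Icc.1 hj).1
    have hj' : (0 : ℝ) < j := by exact_mod_cast hj1
    have h2 : (2 : ℝ) ≤ 2 ^ j := le_self_pow₀ one_le_two (by lia)
    have h3 : (-1 : ℝ) ≤ (-1) ^ j := by
      rcases neg_one_pow_eq_or ℝ j with h | h <;> norm_num [h]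
    refine mul_le_mul_of_nonneg_right ?_ (abs_nonneg _)
    rw [div_le_div_iff₀ (by positivity) (by positivity)]
    nlinarith

lemma half_prod_le_E1 {n : ℕ} (hn : Odd n) :
    1 / 2 * ∏ j ∈ Finset.Icc 1 (n + 1), (2 : ℝ) ^ j / (16 * j) * |((bernoulli (2 * j) : ℚ) : ℝ)|
      ≤ E1 n := by
  obtain ⟨m, hm⟩ : ∃ m, n + 1 = 2 * m := by
    obtain ⟨k, rfl⟩ := hn
    exact ⟨k + 1, by ring⟩
  have hn0 : (0 : ℝ) ≤ n := n.cast_nonneg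
  have hfac : ∀ j ∈ Finset.Icc 1 (2 * m),
      0 ≤ ((2 : ℝ) ^ (2 * j) - 1) / (4 * j) * |((bernoulli (2 * j) : ℚ) : ℝ)| := fun j _ => by
    have : (1 : ℝ) ≤ 2 ^ (2 * j) := one_le_pow₀ one_le_two
    exact mul_nonneg (div_nonneg (by linarith) (by positivity)) (abs_nonneg _)
  unfold E1
  rw [hm, Nat.mul_div_cancel_left m two_pos, mul_assoc]
  refine mul_le_mul (by linarith) ?_ (Finset.prod_nonneg fun j _ => by positivity) (by positivity)
  refine le_trans ?_ (mul_le_mul_of_nonneg_left (prod_one_div_two_pow_succ_le m)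
    (Finset.prod_nonneg hfac))
  rw [← Finset.prod_mul_distrib]
  refine Finset.prod_le_prod (fun j _ => by positivity) fun j hj => ?_
  have hj1 : 1 ≤ j := (Finset.mem_Icc.1 hj).1
  have hj' : (0 : ℝ) < j := by exact_mod_cast hj1
  have h2 : (2 : ℝ) ≤ 2 ^ j := le_self_pow₀ one_le_two (by lia)
  rw [mul_right_comm]
  refine mul_le_mul_of_nonneg_right ?_ (abs_nonneg _)
  rw [div_mul_div_comm, mul_one, div_le_div_iff₀ (by positivity) (by positivity), pow_succ,
    mul_comm 2 j, pow_mul]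
  nlinarith [mul_nonneg hj'.le (show (0 : ℝ) ≤ (2 ^ j) ^ 2 - 2 by nlinarith)]

/-- **Part of Corollary D of the paper**: the minimal covolume `χ(Γ^s_n)` of a
nonuniform lattice in `Sp(n,1)` grows super-exponentially. -/
theorem Es_superexponential (c : ℝ) (hc : 0 < c) :
    Tendsto (fun n : ℕ => Es n / c ^ n) atTop atTop := by
  have hg := (tendsto_prod_Icc_div_pow_atTop (fun j => by positivity)
    tendsto_factorial_two_mul_div_pow_atTop hc).const_mul_atTop (show (0 : ℝ) < 1 / 2 by norm_num)
  refine tendsto_atTop_mono (fun n => ?_) hg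
  rw [← mul_div_assoc]
  refine div_le_div_of_nonneg_right ?_ (by positivity)
  refine (mul_le_mul_of_nonneg_left (Finset.prod_le_prod (fun j _ => by positivity) fun j hj =>
    factorial_div_le_two_pow_div_mul_abs_bernoulli (Finset.mem_Icc.1 hj).1) (by norm_num)).trans ?_
  unfold Es
  split_ifs with h
  · exact half_prod_le_E0 n
  · exact half_prod_le_E1 (Nat.not_even_iff_odd.1 h)
end

section
/- For n ≥ 2 define E₀(n) = ((n+1)/2)·∏_{j=1}^{n+1} ((2^j + (−1)^j)/(4j))·|B_{2j}| and, for n odd, E₁(n) = ((n+1)/2)·∏_{j=1}^{n+1} ((2^{2j} − 1)/(4j))·|B_{2j}| · ∏_{j=1}^{(n+1)/2} 1/(2^{4j} − 1), where B_m is the m-th Bernoulli number; set E_s(n) = E₀(n) for n even and E₁(n) for n odd. Then for every n ≥ 2 one has E₁(5) ≤ E_s(n), with equality if and only if n = 5. -/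
open Finset

theorem bernoulli'_six : bernoulli' 6 = 1 / 42 := by
  rw [bernoulli'_def]
  norm_num [sum_range_succ, Nat.choose, bernoulli'_eq_zero_of_odd (n := 5) (by decide)]

theorem bernoulli'_eight : bernoulli' 8 = -1 / 30 := by
  rw [bernoulli'_def]
  norm_num [sum_range_succ, Nat.choose, bernoulli'_eq_zero_of_odd (n := 5) (by decide),
    bernoulli'_eq_zero_of_odd (n := 7) (by decide), bernoulli'_six]

theorem bernoulli'_ten : bernoulli' 10 = 5 / 66 := by
  rw [bernoulli'_def]
  norm_num [sum_range_succ, Nat.choose, bernoulli'_eq_zero_of_odd (n := 5) (by decide),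
    bernoulli'_eq_zero_of_odd (n := 7) (by decide), bernoulli'_eq_zero_of_odd (n := 9) (by decide),
    bernoulli'_six, bernoulli'_eight]

theorem bernoulli'_twelve : bernoulli' 12 = -691 / 2730 := by
  rw [bernoulli'_def]
  norm_num [sum_range_succ, Nat.choose, bernoulli'_eq_zero_of_odd (n := 5) (by decide),
    bernoulli'_eq_zero_of_odd (n := 7) (by decide), bernoulli'_eq_zero_of_odd (n := 9) (by decide),
    bernoulli'_eq_zero_of_odd (n := 11) (by decide), bernoulli'_six, bernoulli'_eight,
    bernoulli'_ten]

/-- The term `1` of the series `∑ 1 / n ^ (2k)` bounds `ζ(2k)` below. -/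
theorem two_mul_factorial_le_abs_bernoulli {k : ℕ} (hk : k ≠ 0) :
    2 * ((2 * k).factorial : ℝ) ≤ (2 * Real.pi) ^ (2 * k) * |((bernoulli (2 * k) : ℚ) : ℝ)| := by
  have h := hasSum_zeta_nat hk
  have h1 : (1 : ℝ) ≤ (-1 : ℝ) ^ (k + 1) * (2 : ℝ) ^ (2 * k - 1) * Real.pi ^ (2 * k) *
      bernoulli (2 * k) / (2 * k).factorial := by
    simpa using le_hasSum h 1 fun n _ => by positivity
  have h2 := h1.trans (le_abs_self _)
  rw [abs_div, abs_mul, abs_mul, abs_mul, abs_pow, abs_neg, abs_one, one_pow, one_mul,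
    Nat.abs_cast, le_div_iff₀ (by positivity), one_mul, abs_of_pos (by positivity),
    abs_of_pos (by positivity)] at h2
  have h3 : (2 : ℝ) ^ (2 * k) = 2 * 2 ^ (2 * k - 1) := by
    rw [← pow_succ']
    congr 1
    omega
  rw [mul_pow, h3]
  linarith

theorem two_pi_pow_le_two_mul_factorial {k : ℕ} (hk : 7 ≤ k) :
    (2 * Real.pi) ^ (2 * k) ≤ 2 * ((2 * k).factorial : ℝ) := by
  have hpi : 2 * Real.pi ≤ 6.2832 := by linarith [Real.pi_lt_d6]
  induction k, hk using Nat.le_induction with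
  | base =>
    refine (pow_le_pow_left₀ (by positivity) hpi _).trans ?_
    norm_num [Nat.factorial]
  | succ k hk ih =>
    have hk' : (7 : ℝ) ≤ k := by exact_mod_cast hk
    have h : (2 * Real.pi) ^ 2 ≤ (2 * (k : ℝ) + 2) * (2 * k + 1) := by
      refine (pow_le_pow_left₀ (by positivity) hpi 2).trans ?_
      nlinarith
    have hf : ((2 * (k + 1)).factorial : ℝ) =
        (2 * (k : ℝ) + 2) * (2 * k + 1) * (2 * k).factorial := by
      rw [show 2 * (k + 1) = 2 * k + 1 + 1 by ring, Nat.factorial_succ, Nat.factorial_succ]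
      push_cast
      ring
    calc (2 * Real.pi) ^ (2 * (k + 1)) = (2 * Real.pi) ^ 2 * (2 * Real.pi) ^ (2 * k) := by ring
      _ ≤ (2 * (k : ℝ) + 2) * (2 * k + 1) * (2 * (2 * k).factorial) := by gcongr
      _ = 2 * ((2 * (k + 1)).factorial : ℝ) := by rw [hf]; ring

theorem one_le_abs_bernoulli {k : ℕ} (hk : 7 ≤ k) :
    1 ≤ |((bernoulli (2 * k) : ℚ) : ℝ)| := by
  have h := (two_pi_pow_le_two_mul_factorial hk).trans
    (two_mul_factorial_le_abs_bernoulli (by omega))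
  exact le_of_mul_le_mul_left (by simpa using h) (by positivity : 0 < (2 * Real.pi) ^ (2 * k))

theorem sixteen_mul_mul_add_one_lt {j : ℕ} (hj : 7 ≤ j) :
    16 * (j : ℝ) * (j + 1) < 2 ^ (2 * j) - 1 := by
  induction j, hj using Nat.le_induction with
  | base => norm_num
  | succ j hj ih =>
    have hj' : (7 : ℝ) ≤ j := by exact_mod_cast hj
    have hp : (2 : ℝ) ^ (2 * (j + 1)) = 2 ^ (2 * j) * 4 := by ring
    rw [hp]
    push_cast
    nlinarith

theorem four_mul_add_one_lt_two_pow {j : ℕ} (hj : 7 ≤ j) : 4 * (j : ℝ) + 1 < 2 ^ j := by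
  induction j, hj using Nat.le_induction with
  | base => norm_num
  | succ j hj ih =>
    have hj' : (7 : ℝ) ≤ j := by exact_mod_cast hj
    rw [pow_succ]
    push_cast
    linarith

theorem one_le_E0_factor {j : ℕ} (hj : 7 ≤ j) :
    1 ≤ ((2 : ℝ) ^ j + (-1 : ℝ) ^ j) / (4 * j) * |((bernoulli (2 * j) : ℚ) : ℝ)| := by
  have hj' : (7 : ℝ) ≤ j := by exact_mod_cast hj
  refine one_le_mul_of_one_le_of_one_le ?_ (one_le_abs_bernoulli hj)
  rw [one_le_div (by positivity)]
  have h := four_mul_add_one_lt_two_pow hj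
  rcases neg_one_pow_eq_or ℝ j with h1 | h1 <;> rw [h1] <;> linarith

theorem one_le_E1_factor {j : ℕ} (hj : 7 ≤ j) :
    1 ≤ ((2 : ℝ) ^ (2 * j) - 1) / (4 * j) * |((bernoulli (2 * j) : ℚ) : ℝ)| *
      (((2 : ℝ) ^ (2 * (j + 1)) - 1) / (4 * (j + 1 : ℕ)) *
        |((bernoulli (2 * (j + 1)) : ℚ) : ℝ)|) * (1 / ((2 : ℝ) ^ (2 * (j + 1)) - 1)) := by
  have hj' : (7 : ℝ) ≤ j := by exact_mod_cast hj
  have hp : (0 : ℝ) < 2 ^ (2 * (j + 1)) - 1 :=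
    sub_pos.mpr (one_lt_pow₀ (by norm_num) (by omega))
  have hB := one_le_mul_of_one_le_of_one_le (one_le_abs_bernoulli hj)
    (one_le_abs_bernoulli (k := j + 1) (by omega))
  have hq : 1 ≤ ((2 : ℝ) ^ (2 * j) - 1) / (16 * j * (j + 1)) :=
    (one_le_div (by positivity)).mpr (sixteen_mul_mul_add_one_lt hj).le
  refine (one_le_mul_of_one_le_of_one_le hq hB).trans_eq ?_
  push_cast
  field_simp
  ring

theorem E0_lt_E0_add_two {n : ℕ} (hn : 5 ≤ n) (hpos : 0 < E0 n) : E0 n < E0 (n + 2) := by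
  have h := one_le_mul_of_one_le_of_one_le (one_le_E0_factor (j := n + 1 + 1) (by omega))
    (one_le_E0_factor (j := n + 2 + 1) (by omega))
  unfold E0 at hpos ⊢
  rw [prod_Icc_succ_top (by omega : 1 ≤ n + 2 + 1),
    prod_Icc_succ_top (by omega : 1 ≤ n + 1 + 1), mul_assoc (∏ _ ∈ _, _)]
  have hP := pos_of_mul_pos_right hpos (by positivity)
  refine mul_lt_mul (by push_cast; linarith) (le_mul_of_one_le_right hP.le h) hP (by positivity)

theorem E1_lt_E1_add_two {n : ℕ} (hn : 5 ≤ n) (hodd : Odd n) (hpos : 0 < E1 n) :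
    E1 n < E1 (n + 2) := by
  have h := one_le_E1_factor (j := n + 1 + 1) (by omega)
  unfold E1 at hpos ⊢
  have hhalf : (n + 2 + 1) / 2 = (n + 1) / 2 + 1 := by omega
  have hexp : 4 * ((n + 1) / 2 + 1) = 2 * (n + 1 + 1 + 1) := by
    obtain ⟨m, rfl⟩ := hodd
    omega
  rw [hhalf, prod_Icc_succ_top (by omega : 1 ≤ n + 2 + 1),
    prod_Icc_succ_top (by omega : 1 ≤ n + 1 + 1),
    prod_Icc_succ_top (by omega : 1 ≤ (n + 1) / 2 + 1), hexp]
  rw [mul_assoc] at hpos ⊢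
  have hP := pos_of_mul_pos_right hpos (by positivity)
  rw [mul_assoc]
  refine mul_lt_mul (by push_cast; linarith)
    ((le_mul_of_one_le_right hP.le h).trans_eq ?_) hP (by positivity)
  ring

theorem E1_five : E1 5 = 21421 / 1288175616000 := by
  norm_num [E1, prod_Icc_succ_top, bernoulli_two, bernoulli_eq_bernoulli'_of_ne_one,
    bernoulli'_six, bernoulli'_eight, bernoulli'_ten, bernoulli'_twelve, abs_of_pos, abs_of_neg]

theorem E1_five_lt_E0_two : E1 5 < E0 2 := by
  rw [E1_five]
  norm_num [E0, prod_Icc_succ_top, bernoulli_two, bernoulli_eq_bernoulli'_of_ne_one,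
    bernoulli'_six, abs_of_pos, abs_of_neg]

theorem E1_five_lt_E1_three : E1 5 < E1 3 := by
  rw [E1_five]
  norm_num [E1, prod_Icc_succ_top, bernoulli_two, bernoulli_eq_bernoulli'_of_ne_one,
    bernoulli'_six, bernoulli'_eight, abs_of_pos, abs_of_neg]

theorem E1_five_lt_E0_four : E1 5 < E0 4 := by
  rw [E1_five]
  norm_num [E0, prod_Icc_succ_top, bernoulli_two, bernoulli_eq_bernoulli'_of_ne_one,
    bernoulli'_six, bernoulli'_eight, bernoulli'_ten, abs_of_pos, abs_of_neg]

theorem E1_five_lt_E0_six : E1 5 < E0 6 := by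
  have h := one_le_E0_factor (j := 7) le_rfl
  rw [E1_five]
  unfold E0
  rw [prod_Icc_succ_top (by norm_num)]
  refine lt_of_lt_of_le ?_ (mul_le_mul_of_nonneg_left (le_mul_of_one_le_right ?_ h)
    (by positivity))
  all_goals
    norm_num [prod_Icc_succ_top, bernoulli_two, bernoulli_eq_bernoulli'_of_ne_one,
      bernoulli'_six, bernoulli'_eight, bernoulli'_ten, bernoulli'_twelve, abs_of_pos, abs_of_neg]

theorem E1_five_pos : 0 < E1 5 := by
  rw [E1_five]
  norm_num

theorem E1_five_lt_E0 (m : ℕ) : E1 5 < E0 (2 * m + 6) := by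
  induction m with
  | zero => exact E1_five_lt_E0_six
  | succ m ih => exact ih.trans (E0_lt_E0_add_two (by omega) (E1_five_pos.trans ih))

theorem E1_five_lt_E1 (m : ℕ) : E1 5 < E1 (2 * m + 7) := by
  induction m with
  | zero => exact E1_lt_E1_add_two le_rfl (by decide) E1_five_pos
  | succ m ih =>
    exact ih.trans (E1_lt_E1_add_two (by omega) ⟨m + 3, by ring⟩ (E1_five_pos.trans ih))

theorem E1_five_lt_Es {n : ℕ} (hn : 2 ≤ n) (h5 : n ≠ 5) : E1 5 < Es n := by
  unfold Es
  split_ifs with h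
  · obtain ⟨k, rfl⟩ := h.exists_two_nsmul
    rw [smul_eq_mul] at *
    rcases (by omega : k = 1 ∨ k = 2 ∨ 3 ≤ k) with rfl | rfl | hk
    · exact E1_five_lt_E0_two
    · exact E1_five_lt_E0_four
    · obtain ⟨m, rfl⟩ := Nat.exists_eq_add_of_le' hk
      exact E1_five_lt_E0 m
  · obtain ⟨k, rfl⟩ := Nat.not_even_iff_odd.mp h
    rcases (by omega : k = 1 ∨ 3 ≤ k) with rfl | hk
    · exact E1_five_lt_E1_three
    · obtain ⟨m, rfl⟩ := Nat.exists_eq_add_of_le' hk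
      exact E1_five_lt_E1 m

/-- **Arithmetic content of Corollary E of the paper**: among the minimal
nonuniform covolumes `χ(Γ^s_n)` for `n ≥ 2`, the smallest value is `χ(Γ¹₅)`,
attained exactly at `n = 5`. -/
theorem E1_five_is_min (n : ℕ) (hn : 2 ≤ n) :
    E1 5 ≤ Es n ∧ (E1 5 = Es n ↔ n = 5) := by
  by_cases h5 : n = 5
  · subst h5
    have h : Es 5 = E1 5 := if_neg (by decide)
    simp [h]
  · have h := E1_five_lt_Es hn h5
    exact ⟨h.le, iff_of_false h.ne h5⟩
end
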